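/- Let a, n ≥ 1 be natural numbers, let α be a string, let T be a leaf bag which is 2^(a−1)·n-bushy from α, and let P₁, …, Pₐ be sets of strings such that T ⊆ P₁ ∪ ⋯ ∪ Pₐ. Then for some i ∈ {1, …, a}, T has a subset which is a leaf bag n-bushy from α for Pᵢ. -/

import Mathlib

/-- A leaf bag: a finite nonempty set of pairwise incomparable strings
(no element is a prefix of another). -/
def IsLeafBag (T : Finset (List ℕ)) : Prop :=
  T.Nonempty ∧ ∀ σ ∈ T, ∀ τ ∈ T, σ ≠ τ → ¬ σ <+: τ

/-- `T` is an `n`-bushy leaf bag from the string `α`. -/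
def BushyFrom (n : ℕ) (α : List ℕ) (T : Finset (List ℕ)) : Prop :=
  IsLeafBag T ∧ (∀ τ ∈ T, α <+: τ) ∧
  ∀ τ : List ℕ, α <+: τ → (∃ ρ ∈ T, τ <+: ρ ∧ τ ≠ ρ) →
    ∃ S : Finset ℕ, n ≤ S.card ∧ ∀ k ∈ S, ∃ ρ ∈ T, (τ ++ [k]) <+: ρ

/-- `T` is `n`-bushy from `α` for the set of strings `P`. -/
def BushyFromFor (n : ℕ) (α : List ℕ) (P : Set (List ℕ)) (T : Finset (List ℕ)) : Prop :=
  BushyFrom n α T ∧ ↑T ⊆ P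

theorem BushyFrom.mono {m n : ℕ} {α : List ℕ} {T : Finset (List ℕ)} (h : n ≤ m)
    (hT : BushyFrom m α T) : BushyFrom n α T :=
  ⟨hT.1, hT.2.1, fun τ hτ hρ =>
    let ⟨S, hS, hk⟩ := hT.2.2 τ hτ hρ
    ⟨S, h.trans hS, hk⟩⟩

theorem IsLeafBag.subset {S T : Finset (List ℕ)} (hT : IsLeafBag T) (h : S ⊆ T)
    (hS : S.Nonempty) : IsLeafBag S :=
  ⟨hS, fun σ hσ τ hτ => hT.2 σ (h hσ) τ (h hτ)⟩

/-- The part of a bushy leaf bag above an extension `β` of `α` is bushy from `β`. -/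
theorem BushyFrom.filter_prefix {m : ℕ} {α β : List ℕ} {T : Finset (List ℕ)}
    (hT : BushyFrom m α T) (hαβ : α <+: β) (hβ : ∃ ρ ∈ T, β <+: ρ) :
    BushyFrom m β (T.filter (β <+: ·)) := by
  obtain ⟨ρ, hρ, hβρ⟩ := hβ
  refine ⟨hT.1.subset (Finset.filter_subset _ _) ⟨ρ, Finset.mem_filter.2 ⟨hρ, hβρ⟩⟩,
    fun τ hτ => (Finset.mem_filter.1 hτ).2, ?_⟩
  rintro τ hβτ ⟨σ, hσ, hτσ⟩
  obtain ⟨S, hS, hk⟩ := hT.2.2 τ (hαβ.trans hβτ) ⟨σ, (Finset.mem_filter.1 hσ).1, hτσ⟩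
  refine ⟨S, hS, fun k hkS => ?_⟩
  obtain ⟨ρ', hρ', hp⟩ := hk k hkS
  exact ⟨ρ', Finset.mem_filter.2 ⟨hρ', hβτ.trans ((List.prefix_append τ [k]).trans hp)⟩, hp⟩

/-- Leaf bags bushy from at least `n ≥ 1` immediate successors of `α`, all contained in one
leaf bag, have a union that is bushy from `α`. -/
theorem BushyFrom.biUnion {n : ℕ} (hn : 1 ≤ n) {α : List ℕ} {T : Finset (List ℕ)}
    (hT : IsLeafBag T) {K : Finset ℕ} (hK : n ≤ K.card) {S : ℕ → Finset (List ℕ)}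
    (hST : ∀ k ∈ K, S k ⊆ T) (hS : ∀ k ∈ K, BushyFrom n (α ++ [k]) (S k)) :
    BushyFrom n α (K.biUnion S) := by
  refine ⟨hT.subset (Finset.biUnion_subset.2 hST) ?_, fun τ hτ => ?_, ?_⟩
  · obtain ⟨k, hk⟩ := Finset.card_pos.1 (hn.trans hK)
    obtain ⟨ρ, hρ⟩ := (hS k hk).1.1
    exact ⟨ρ, Finset.mem_biUnion.2 ⟨k, hk, hρ⟩⟩
  · obtain ⟨k, hk, hτk⟩ := Finset.mem_biUnion.1 hτ
    exact (List.prefix_append α [k]).trans ((hS k hk).2.1 τ hτk)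
  · rintro τ hατ ⟨ρ, hρ, hτρ, hne⟩
    obtain ⟨k, hk, hρk⟩ := Finset.mem_biUnion.1 hρ
    by_cases hτ : α = τ
    · subst hτ
      refine ⟨K, hK, fun j hj => ?_⟩
      obtain ⟨σ, hσ⟩ := (hS j hj).1.1
      exact ⟨σ, Finset.mem_biUnion.2 ⟨j, hj, hσ⟩, (hS j hj).2.1 σ hσ⟩
    · have hlen : (α ++ [k]).length ≤ τ.length := by
        have h : α.length ≠ τ.length := fun h => hτ (hατ.eq_of_length h)
        have := hατ.length_le
        simp only [List.length_append, List.length_singleton]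
        omega
      obtain ⟨L, hL, hLS⟩ := (hS k hk).2.2 τ
        (List.prefix_of_prefix_length_le ((hS k hk).2.1 ρ hρk) hτρ hlen) ⟨ρ, hρk, hτρ, hne⟩
      refine ⟨L, hL, fun j hj => ?_⟩
      obtain ⟨σ, hσ, hp⟩ := hLS j hj
      exact ⟨σ, Finset.mem_biUnion.2 ⟨k, hk, hσ⟩, hp⟩

/-- Pigeonhole for leaf bags: covering an `m`-bushy leaf bag by `a` sets, with `a * n ≤ m`,
yields an `n`-bushy part inside one of the sets. -/
theorem BushyFrom.exists_bushyFromFor {a m n : ℕ} (ha : 1 ≤ a) (hn : 1 ≤ n) (hm : a * n ≤ m)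
    {α : List ℕ} {T : Finset (List ℕ)} (hT : BushyFrom m α T) {P : Fin a → Set (List ℕ)}
    (hP : ↑T ⊆ ⋃ i, P i) :
    ∃ i : Fin a, ∃ S ⊆ T, BushyFromFor n α (P i) S := by
  obtain ⟨d, hd⟩ : ∃ d, ∀ ρ ∈ T, ρ.length < α.length + d :=
    ⟨T.sup List.length + 1, fun ρ hρ => by
      have := Finset.le_sup (f := List.length) hρ
      omega⟩
  induction d generalizing α T with
  | zero =>
    obtain ⟨ρ, hρ⟩ := hT.1.1
    have := (hT.2.1 ρ hρ).length_le
    have := hd ρ hρ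
    omega
  | succ d ih =>
    by_cases hα : α ∈ T
    · obtain ⟨i, hi⟩ := Set.mem_iUnion.1 (hP hα)
      refine ⟨i, T, subset_rfl, hT.mono ((Nat.le_mul_of_pos_left n ha).trans hm), ?_⟩
      intro ρ hρ
      have h : α = ρ := by
        by_contra h
        exact hT.1.2 α hα ρ hρ h (hT.2.1 ρ hρ)
      exact h ▸ hi
    · obtain ⟨ρ, hρ⟩ := hT.1.1
      obtain ⟨K, hK, hKT⟩ := hT.2.2 α List.prefix_rfl
        ⟨ρ, hρ, hT.2.1 ρ hρ, fun h => hα (h ▸ hρ)⟩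
      have hsplit : ∀ k, ∃ i : Fin a, ∃ S ⊆ T, k ∈ K → BushyFromFor n (α ++ [k]) (P i) S := by
        intro k
        by_cases hk : k ∈ K
        · have hsub := Finset.filter_subset (α ++ [k] <+: ·) T
          obtain ⟨i, S, hS, hB⟩ := ih (hT.filter_prefix (List.prefix_append α [k]) (hKT k hk))
            ((Finset.coe_subset.2 hsub).trans hP) fun σ hσ => by
              have := hd σ (hsub hσ)
              simp only [List.length_append, List.length_singleton]
              omega
          exact ⟨i, S, hS.trans hsub, fun _ => hB⟩
        · exact ⟨⟨0, ha⟩, ∅, Finset.empty_subset T, fun h => absurd h hk⟩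
      choose c S hST hS using hsplit
      obtain ⟨i, -, hi⟩ := Finset.exists_le_card_fiber_of_mul_le_card_of_maps_to
        (s := K) (t := (Finset.univ : Finset (Fin a))) (f := c) (n := n)
        (fun _ _ => Finset.mem_univ _) ⟨⟨0, ha⟩, Finset.mem_univ _⟩
        (by simpa using hm.trans hK)
      refine ⟨i, (K.filter (c · = i)).biUnion S, Finset.biUnion_subset.2 fun k _ => hST k,
        BushyFrom.biUnion hn hT.1 hi (fun k _ => hST k)
          fun k hk => (hS k (Finset.mem_filter.1 hk).1).1, ?_⟩
      intro σ hσ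
      obtain ⟨k, hk, hσk⟩ := Finset.mem_biUnion.1 hσ
      obtain ⟨hkK, rfl⟩ := Finset.mem_filter.1 hk
      exact (hS k hkK).2 hσk

/-- Lemma 3: if `T` is `2^(a-1)·n`-bushy from `α` and `T ⊆ P₁ ∪ ⋯ ∪ Pₐ`, then for
some `i`, `T` has a subset which is `n`-bushy from `α` for `Pᵢ`. -/
theorem leafBag_multiSplit (a n : ℕ) (ha : 1 ≤ a) (hn : 1 ≤ n) (α : List ℕ)
    (T : Finset (List ℕ)) (hT : BushyFrom (2 ^ (a - 1) * n) α T)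
    (P : Fin a → Set (List ℕ)) (hP : ↑T ⊆ ⋃ i, P i) :
    ∃ i : Fin a, ∃ S ⊆ T, BushyFromFor n α (P i) S := by
  refine hT.exists_bushyFromFor ha hn (Nat.mul_le_mul_right n ?_) hP
  have := Nat.lt_two_pow_self (n := a - 1)
  omega
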